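/- arXiv:2502.04678 — 3 statements merged into one kernel-verified Lean document; each statement's English description precedes it below -/
import Mathlib

section
/- Let ι > 0, L > 0, γ ≥ 4ι/L, w > 0, and ŵ ≥ 0 with |ŵ − w| ≤ 2·max{ √(w·ι/L), ι/L }. Define β = (w + γ)/(ŵ + (3/2)γ). Then: (i) 1/2 ≤ β ≤ 2, and (ii) |1 − β| ≤ 3·√(ι/(w·L)) + γ·√L/(4·√(ι·w)). -/
set_option maxHeartbeats 1000000 in
/-- Lemma 8 of Schneider–Zimmert extended to the graphical setting: if
`γ ≥ 4ι/L` and `|ŵ - w| ≤ 2 max{√(wι/L), ι/L}`, then the ratio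
`β = (w + γ)/(ŵ + (3/2)γ)` satisfies `1/2 ≤ β ≤ 2` and
`|1 - β| ≤ 3 √(ι/(wL)) + γ √L / (4 √(ιw))`. Here `wHat` stands for `ŵ`. -/
theorem stmt7 (ι L γ w wHat : ℝ) (hι : 0 < ι) (hL : 0 < L)
    (hγ : 4 * ι / L ≤ γ) (hw : 0 < w) (hwHat : 0 ≤ wHat)
    (hconc : |wHat - w| ≤ 2 * max (Real.sqrt (w * ι / L)) (ι / L)) :
    (1 / 2 ≤ (w + γ) / (wHat + (3 / 2) * γ) ∧ (w + γ) / (wHat + (3 / 2) * γ) ≤ 2) ∧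
    |1 - (w + γ) / (wHat + (3 / 2) * γ)| ≤
      3 * Real.sqrt (ι / (w * L)) + γ * Real.sqrt L / (4 * Real.sqrt (ι * w)) := by
  obtain ⟨l, hl, rfl⟩ : ∃ l : ℝ, 0 < l ∧ L = l ^ 2 :=
    ⟨Real.sqrt L, Real.sqrt_pos.2 hL, (Real.sq_sqrt hL.le).symm⟩
  obtain ⟨s, hs, rfl⟩ : ∃ s : ℝ, 0 < s ∧ w = s ^ 2 :=
    ⟨Real.sqrt w, Real.sqrt_pos.2 hw, (Real.sq_sqrt hw.le).symm⟩
  obtain ⟨a, ha, rfl⟩ : ∃ a : ℝ, 0 < a ∧ ι = (a * l) ^ 2 := by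
    refine ⟨Real.sqrt ι / l, div_pos (Real.sqrt_pos.2 hι) hl, ?_⟩
    rw [div_mul_cancel₀ _ hl.ne', Real.sq_sqrt hι.le]
  have e1 : (a * l) ^ 2 / l ^ 2 = a ^ 2 := by field_simp
  have e2 : Real.sqrt (s ^ 2 * (a * l) ^ 2 / l ^ 2) = s * a := by
    rw [show s ^ 2 * (a * l) ^ 2 / l ^ 2 = (s * a) ^ 2 by field_simp]
    exact Real.sqrt_sq (by positivity)
  have e3 : Real.sqrt ((a * l) ^ 2 / (s ^ 2 * l ^ 2)) = a / s := by
    rw [show (a * l) ^ 2 / (s ^ 2 * l ^ 2) = (a / s) ^ 2 by field_simp]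
    exact Real.sqrt_sq (by positivity)
  have e4 : Real.sqrt ((a * l) ^ 2 * s ^ 2) = a * l * s := by
    rw [← mul_pow]
    exact Real.sqrt_sq (by positivity)
  have e5 : 3 * (a / s) + γ * l / (4 * (a * l * s)) = (12 * a ^ 2 + γ) / (4 * a * s) := by
    field_simp
    ring
  rw [e1, e2] at hconc
  rw [mul_div_assoc, e1] at hγ
  rw [e3, e4, Real.sqrt_sq hl.le, e5]
  have ha2 : 0 < a ^ 2 := by positivity
  have hg : 0 < γ := by linarith
  have hD : 0 < wHat + 3 / 2 * γ := by linarith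
  have has : 0 < a * s := by positivity
  obtain ⟨h1, h2⟩ := abs_le.1 hconc
  have hb : 1 / 2 ≤ (s ^ 2 + γ) / (wHat + (3 / 2) * γ) ∧
      (s ^ 2 + γ) / (wHat + (3 / 2) * γ) ≤ 2 := by
    rw [le_div_iff₀ hD, div_le_iff₀ hD]
    rcases le_total a s with h | h
    · rw [max_eq_left (by nlinarith)] at h1 h2
      constructor
      · nlinarith [sq_nonneg (s - a)]
      · nlinarith [sq_nonneg (s - 2 * a)]
    · rw [max_eq_right (by nlinarith)] at h1 h2
      constructor <;> nlinarith
  refine ⟨hb, ?_⟩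
  rcases le_total a s with h | h
  · rw [max_eq_left (by nlinarith)] at h1 h2
    have e6 : 1 - (s ^ 2 + γ) / (wHat + (3 / 2) * γ) =
        (wHat - s ^ 2 + γ / 2) / (wHat + 3 / 2 * γ) := by
      field_simp
      ring
    rw [e6, abs_div, abs_of_pos hD, div_le_div_iff₀ hD (by positivity)]
    have hk : 0 < 12 * a ^ 2 + γ := by positivity
    rcases abs_cases (wHat - s ^ 2 + γ / 2) with ⟨h3, h4⟩ | ⟨h3, h4⟩ <;> rw [h3]
    · have key : (2 * (s * a) + γ / 2) * (4 * a * s) ≤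
          (12 * a ^ 2 + γ) * (s ^ 2 + 2 * (s * a) + 3 / 2 * γ) := by
        have : 0 ≤ a ^ 2 * s ^ 2 := by positivity
        have : 0 ≤ a ^ 3 * s := by positivity
        have : 0 ≤ a ^ 2 * γ := by positivity
        have : 0 ≤ γ * s ^ 2 := by positivity
        nlinarith [sq_nonneg γ]
      -- decrease from the extreme value of wHat
      have hD' : 0 < s ^ 2 + 2 * (s * a) + 3 / 2 * γ := by positivity
      have hfrac : (wHat - s ^ 2 + γ / 2) * (s ^ 2 + 2 * (s * a) + 3 / 2 * γ) ≤
          (2 * (s * a) + γ / 2) * (wHat + 3 / 2 * γ) := by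
        have h7 : 0 ≤ (2 * (s * a) - (wHat - s ^ 2)) * (s ^ 2 + γ) :=
          mul_nonneg (by linarith) (by positivity)
        linarith
      have k1 := mul_le_mul_of_nonneg_right hfrac (by positivity : 0 ≤ 4 * a * s)
      have k2 := mul_le_mul_of_nonneg_right key hD.le
      refine le_of_mul_le_mul_right ?_ hD'
      linarith
    · have k1 : -(wHat - s ^ 2 + γ / 2) * (4 * a * s) ≤ (2 * (s * a) - γ / 2) * (4 * a * s) :=
        mul_le_mul_of_nonneg_right (by linarith) (by positivity)
      have k2 : (12 * a ^ 2 + γ) * (s ^ 2 - 2 * (s * a) + 3 / 2 * γ) ≤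
          (12 * a ^ 2 + γ) * (wHat + 3 / 2 * γ) :=
        mul_le_mul_of_nonneg_left (by linarith) hk.le
      have k3 : 4 * a ^ 2 * s ^ 2 ≤ γ * s ^ 2 :=
        mul_le_mul_of_nonneg_right hγ (by positivity)
      have k4 : a ^ 2 * (4 * a ^ 2) ≤ a ^ 2 * γ :=
        mul_le_mul_of_nonneg_left hγ (by positivity)
      have k5 : 0 ≤ a ^ 2 * (s - 3 / 2 * a) ^ 2 := by positivity
      have k6 : 0 ≤ a ^ 4 := by positivity
      linarith [sq_nonneg γ]
  · have : 1 ≤ (12 * a ^ 2 + γ) / (4 * a * s) := by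
      rw [le_div_iff₀ (by positivity)]
      nlinarith
    rw [abs_le]
    constructor <;> linarith [hb.1, hb.2]
end

section
/- Let ι > 0, L > 0, K ≥ 1, γ ≥ 16ι/L with exp(−ι) ≤ γ/(8K), and let w ∈ (0, 1/2]. Let ŵ be a nonnegative random variable with E[ŵ] = w and ŵ − w ∈ [−1/2, 1/2] almost surely, let F be the indicator of the event |ŵ − w| ≤ 2·max{ √(w·ι/L), ι/L }, and assume P(F = 0) ≤ 2K·exp(−ι). Define β = (w + γ)/(ŵ + (3/2)γ). Then 0 ≤ E[(1 − β)·F] ≤ γ/w. -/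
open MeasureTheory

set_option maxHeartbeats 2000000

/-- Lemma 10 of Schneider–Zimmert extended: if `γ ≥ 16ι/L`, `exp(-ι) ≤ γ/(8K)`,
`ŵ` is a nonnegative random variable with mean `w`, `ŵ - w ∈ [-1/2,1/2]` a.s.,
`F` is the indicator of the concentration event and `P(F = 0) ≤ 2K exp(-ι)`, then
`0 ≤ E[(1 - β) F] ≤ γ/w` where `β = (w + γ)/(ŵ + (3/2)γ)`. `wHat` stands for `ŵ`. -/
theorem stmt8 {Ω : Type*} [MeasurableSpace Ω] (μ : Measure Ω) [IsProbabilityMeasure μ]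
    (ι L γ w : ℝ) (K : ℕ) (hι : 0 < ι) (hL : 0 < L) (hK : 1 ≤ K)
    (hγ : 16 * ι / L ≤ γ) (hexp : Real.exp (-ι) ≤ γ / (8 * K))
    (hw : w ∈ Set.Ioc (0 : ℝ) (1 / 2))
    (wHat : Ω → ℝ) (hmeas : Measurable wHat) (hnneg : ∀ ω, 0 ≤ wHat ω)
    (hmean : ∫ ω, wHat ω ∂μ = w)
    (hbdd : ∀ᵐ ω ∂μ, wHat ω - w ∈ Set.Icc (-(1 / 2) : ℝ) (1 / 2))
    (F : Ω → ℝ)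
    (hF : ∀ ω, F ω =
      if |wHat ω - w| ≤ 2 * max (Real.sqrt (w * ι / L)) (ι / L) then 1 else 0)
    (hPF : μ {ω | F ω = 0} ≤ ENNReal.ofReal (2 * K * Real.exp (-ι))) :
    0 ≤ ∫ ω, (1 - (w + γ) / (wHat ω + (3 / 2) * γ)) * F ω ∂μ ∧
      ∫ ω, (1 - (w + γ) / (wHat ω + (3 / 2) * γ)) * F ω ∂μ ≤ γ / w := by
  obtain ⟨hw0, hw1⟩ := hw
  have hi : 0 < ι / L := by positivity
  have hγi : 16 * (ι / L) ≤ γ := by rw [← mul_div_assoc]; exact hγ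
  have hwi : w * ι / L = w * (ι / L) := by ring
  rw [hwi] at hF
  set t := ι / L with ht
  have hγ0 : 0 < γ := by linarith
  have hK' : (1 : ℝ) ≤ K := by exact_mod_cast hK
  have hKe : K * Real.exp (-ι) ≤ γ / 8 := by
    have : (K : ℝ) * (γ / (8 * K)) = γ / 8 := by field_simp
    rw [← this]; gcongr
  have hFm : Measurable F := by
    have : F = fun ω => if |wHat ω - w| ≤ 2 * max (Real.sqrt (w * t)) t then 1 else 0 := funext hF
    rw [this]
    exact Measurable.ite (measurableSet_le (by fun_prop) measurable_const)
      measurable_const measurable_const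
  have hF01 : ∀ ω, F ω = 0 ∨ F ω = 1 := by
    intro ω; rw [hF]; split_ifs <;> simp
  have hFi : Integrable F μ := by
    refine Integrable.of_bound hFm.aestronglyMeasurable 1 (ae_of_all _ fun ω => ?_)
    rcases hF01 ω with h | h <;> simp [h]
  have hwHi : Integrable wHat μ := by
    refine Integrable.of_bound hmeas.aestronglyMeasurable 1 ?_
    filter_upwards [hbdd] with ω h
    rw [Real.norm_eq_abs, abs_of_nonneg (hnneg ω)]
    linarith [h.2]
  have hxi : Integrable (fun ω => wHat ω - w) μ := hwHi.sub (integrable_const _)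
  have hx0 : ∫ ω, (wHat ω - w) ∂μ = 0 := by
    rw [integral_sub hwHi (integrable_const _), hmean]; simp
  have hxFi : Integrable (fun ω => (wHat ω - w) * F ω) μ := by
    refine Integrable.of_bound (by fun_prop) (1 / 2) ?_
    filter_upwards [hbdd] with ω h
    rw [Real.norm_eq_abs]
    rcases hF01 ω with h' | h'
    · simp [h']
    · rw [h', mul_one, abs_le]; exact h
  have hGi : Integrable (fun ω => (1 - F ω) / 2) μ := ((integrable_const _).sub hFi).div_const 2
  have hp : 1 - ∫ ω, F ω ∂μ = μ.real {ω | F ω = 0} := by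
    have hs : MeasurableSet {ω | F ω = 0} := hFm (measurableSet_singleton 0)
    rw [← integral_indicator_one hs]
    have : (Set.indicator {ω | F ω = 0} (1 : Ω → ℝ)) = fun ω => 1 - F ω := by
      funext ω
      rcases hF01 ω with h | h <;> simp [Set.indicator, h]
    rw [this, integral_sub (integrable_const _) hFi]; simp
  have hp0 : 0 ≤ 1 - ∫ ω, F ω ∂μ := by rw [hp]; exact measureReal_nonneg
  have hp1 : 1 - ∫ ω, F ω ∂μ ≤ γ / 4 := by
    rw [hp]
    have := ENNReal.toReal_le_of_le_ofReal (by positivity) hPF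
    calc _ ≤ _ := this
      _ ≤ _ := by linarith
  have hGe : ∫ ω, (1 - F ω) / 2 ∂μ = (1 - ∫ ω, F ω ∂μ) / 2 := by
    rw [integral_div, integral_sub (integrable_const _) hFi]; simp
  have hxu : ∫ ω, (wHat ω - w) * F ω ∂μ ≤ γ / 8 := by
    have : ∫ ω, (wHat ω - w) * F ω ∂μ ≤ ∫ ω, ((wHat ω - w) + (1 - F ω) / 2) ∂μ := by
      refine integral_mono_ae hxFi (hxi.add hGi) ?_
      filter_upwards [hbdd] with ω h
      rcases hF01 ω with h' | h' <;> simp only [h'] <;> linarith [h.1]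
    rw [integral_add hxi hGi, hx0, hGe] at this
    linarith
  have hxl : -(γ / 8) ≤ ∫ ω, (wHat ω - w) * F ω ∂μ := by
    have : ∫ ω, ((wHat ω - w) - (1 - F ω) / 2) ∂μ ≤ ∫ ω, (wHat ω - w) * F ω ∂μ := by
      refine integral_mono_ae (hxi.sub hGi) hxFi ?_
      filter_upwards [hbdd] with ω h
      rcases hF01 ω with h' | h' <;> simp only [h'] <;> linarith [h.2]
    rw [integral_sub hxi hGi, hx0, hGe] at this
    linarith
  have hint : Integrable (fun ω => (1 - (w + γ) / (wHat ω + (3 / 2) * γ)) * F ω) μ := by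
    refine Integrable.of_bound (by fun_prop) (1 + (w + γ) / ((3 / 2) * γ)) (ae_of_all _ fun ω => ?_)
    have h1 : 0 ≤ (w + γ) / (wHat ω + (3 / 2) * γ) := by have := hnneg ω; positivity
    have h2 : (w + γ) / (wHat ω + (3 / 2) * γ) ≤ (w + γ) / ((3 / 2) * γ) := by
      gcongr; linarith [hnneg ω]
    rw [Real.norm_eq_abs]
    rcases hF01 ω with h | h
    · simp only [h, mul_zero, abs_zero]; linarith
    · rw [h, mul_one, abs_le]; constructor <;> linarith
  set c := w + 3 / 2 * γ with hc
  have hc0 : 0 < c := by positivity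
  set m := (w + γ) / c ^ 2 with hm
  have hm0 : 0 ≤ m := by positivity
  have hmc : m ≤ 1 / c := by
    rw [hm, div_le_div_iff₀ (by positivity) hc0]
    nlinarith
  have hmγ : m * (γ / 8) ≤ γ / c / 8 := by
    calc m * (γ / 8) ≤ 1 / c * (γ / 8) := by gcongr
      _ = _ := by ring
  have hγc : 0 < γ / c := by positivity
  have hlin : ∀ a : ℝ, Integrable (fun ω => a * F ω + m * ((wHat ω - w) * F ω)) μ :=
    fun a => (hFi.const_mul a).add (hxFi.const_mul m)
  have hlinI : ∀ a : ℝ, ∫ ω, (a * F ω + m * ((wHat ω - w) * F ω)) ∂μ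
      = a * (∫ ω, F ω ∂μ) + m * ∫ ω, (wHat ω - w) * F ω ∂μ := fun a => by
    rw [integral_add (hFi.const_mul a) (hxFi.const_mul m), integral_const_mul, integral_const_mul]
  have hid : ∀ ω, 1 - (w + γ) / (wHat ω + (3 / 2) * γ) = γ / c / 2 + m * (wHat ω - w)
      - m * (wHat ω - w) ^ 2 / (wHat ω + (3 / 2) * γ) := by
    intro ω
    have h1 : wHat ω + (3 / 2) * γ ≠ 0 := by have := hnneg ω; positivity
    have h3 : w + 3 / 2 * γ ≠ 0 := hc0.ne'
    rw [hm, hc]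
    generalize hd : wHat ω + (3 / 2) * γ = d at *
    have : wHat ω = d - 3 / 2 * γ := by linarith
    rw [this]
    field_simp
    ring
  constructor
  · rcases le_or_gt w γ with hwγ | hwγ
    · refine integral_nonneg fun ω => ?_
      have hd : 0 < wHat ω + (3 / 2) * γ := by have := hnneg ω; positivity
      show 0 ≤ (1 - (w + γ) / (wHat ω + (3 / 2) * γ)) * F ω
      rw [hF]
      split_ifs with h
      · rw [mul_one, sub_nonneg, div_le_one hd]
        have hs : Real.sqrt (w * t) ≤ γ / 4 := by
          apply Real.sqrt_le_iff.2
          constructor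
          · positivity
          · nlinarith
        have : max (Real.sqrt (w * t)) t ≤ γ / 4 := max_le hs (by linarith)
        linarith [(abs_le.1 h).1]
      · simp
    · have key : ∫ ω, (γ / c / 6 * F ω + m * ((wHat ω - w) * F ω)) ∂μ
          ≤ ∫ ω, (1 - (w + γ) / (wHat ω + (3 / 2) * γ)) * F ω ∂μ := by
        refine integral_mono (hlin _) hint fun ω => ?_
        show γ / c / 6 * F ω + m * ((wHat ω - w) * F ω) ≤
          (1 - (w + γ) / (wHat ω + (3 / 2) * γ)) * F ω
        have hd : 0 < wHat ω + (3 / 2) * γ := by have := hnneg ω; positivity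
        rw [hid]
        by_cases h : |wHat ω - w| ≤ 2 * max (Real.sqrt (w * t)) t
        · rw [hF, if_pos h]
          have hts : t ≤ Real.sqrt (w * t) := Real.le_sqrt_of_sq_le (by nlinarith)
          rw [max_eq_left hts] at h
          have hsq : Real.sqrt (w * t) ^ 2 = w * t := Real.sq_sqrt (by positivity)
          have hx2 : (wHat ω - w) ^ 2 ≤ w * γ / 4 := by
            have h4 := sq_le_sq' (abs_le.1 h).1 (abs_le.1 h).2
            nlinarith
          have hxa : -((w + γ) / 4) ≤ wHat ω - w := by
            have := abs_le_of_sq_le_sq' (show (wHat ω - w) ^ 2 ≤ ((w + γ) / 4) ^ 2 by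
              have h5 := sq_nonneg (w - γ); ring_nf at hx2 h5 ⊢; linarith) (by positivity)
            exact this.1
          have hq : m * (wHat ω - w) ^ 2 / (wHat ω + (3 / 2) * γ) ≤ γ / c / 3 := by
            have hdl : 3 / 4 * (w + γ) ≤ wHat ω + (3 / 2) * γ := by linarith
            calc m * (wHat ω - w) ^ 2 / (wHat ω + (3 / 2) * γ)
                ≤ m * (c * γ / 4) / (3 / 4 * (w + γ)) := by
                  have : w * γ / 4 ≤ c * γ / 4 := by
                    have : w ≤ c := by linarith
                    gcongr
                  have := hx2.trans this
                  gcongr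
              _ = γ / c / 3 := by
                  have : w + γ ≠ 0 := by positivity
                  rw [hm]; field_simp
          linarith
        · rw [hF, if_neg h]; simp
      rw [hlinI] at key
      refine le_trans ?_ key
      have hEF : 7 / 8 ≤ ∫ ω, F ω ∂μ := by linarith
      have h1 : γ / c / 6 * (7 / 8) ≤ γ / c / 6 * ∫ ω, F ω ∂μ := by gcongr
      have h2 : m * (-(γ / 8)) ≤ m * ∫ ω, (wHat ω - w) * F ω ∂μ := by gcongr
      linarith
  · have key : ∫ ω, (1 - (w + γ) / (wHat ω + (3 / 2) * γ)) * F ω ∂μ ≤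
        ∫ ω, (γ / c / 2 * F ω + m * ((wHat ω - w) * F ω)) ∂μ := by
      refine integral_mono hint (hlin _) fun ω => ?_
      show (1 - (w + γ) / (wHat ω + (3 / 2) * γ)) * F ω ≤
        γ / c / 2 * F ω + m * ((wHat ω - w) * F ω)
      have : 0 ≤ m * (wHat ω - w) ^ 2 / (wHat ω + (3 / 2) * γ) := by
        have := hnneg ω; positivity
      rw [hid]
      rcases hF01 ω with h | h <;> rw [h] <;> linarith
    rw [hlinI] at key
    have h1 : γ / c / 2 * ∫ ω, F ω ∂μ ≤ γ / c / 2 * 1 := by gcongr; linarith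
    have h2 : m * ∫ ω, (wHat ω - w) * F ω ∂μ ≤ m * (γ / 8) := by gcongr
    have h3 : γ / c ≤ γ / w := by gcongr; linarith
    linarith
end

section
/- Let p̃ ∈ Δ([K]), let η > 0 and M ≥ 0 with η·M ≤ 1/2, let S_1, …, S_K ∈ [0, M], and let β_1, …, β_K ∈ [0, 2] (so that |1 − β_k| ≤ 1 for all k). Define p ∈ Δ([K]) by p_k ∝ p̃_k·exp(η·(1 − β_k)·S_k). Then Σ_{k=1}^K |p̃_k − p_k|·|1 − β_k| ≤ 3·Σ_{k=1}^K p̃_k·(1 − β_k)². -/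
/-- Abstract form of Lemma 12 of Schneider–Zimmert (comparison of the FTRL iterate
and the counterfactual iterate): if `p ∝ p̃ ∘ exp(η (1 - β) S)` with `S_k ∈ [0, M]`,
`β_k ∈ [0, 2]` and `η M ≤ 1/2`, then
`∑_k |p̃_k - p_k| |1 - β_k| ≤ 3 ∑_k p̃_k (1 - β_k)²`. Here `pt` stands for `p̃`. -/
theorem stmt10 (K : ℕ) (pt : Fin K → ℝ) (hpt0 : ∀ k, 0 ≤ pt k) (hpt1 : ∑ k, pt k = 1)
    (η M : ℝ) (hη : 0 < η) (hM : 0 ≤ M) (hηM : η * M ≤ 1 / 2)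
    (S β : Fin K → ℝ) (hS : ∀ k, S k ∈ Set.Icc (0 : ℝ) M)
    (hβ : ∀ k, β k ∈ Set.Icc (0 : ℝ) 2)
    (p : Fin K → ℝ)
    (hp : ∀ k, p k = pt k * Real.exp (η * (1 - β k) * S k) /
        ∑ j, pt j * Real.exp (η * (1 - β j) * S j)) :
    ∑ k, |pt k - p k| * |1 - β k| ≤ 3 * ∑ k, pt k * (1 - β k) ^ 2 := by
  have hd0 : ∀ k, 0 ≤ |1 - β k| := fun k => abs_nonneg _
  have hd1 : ∀ k, |1 - β k| ≤ 1 := fun k => by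
    have h := hβ k
    rw [abs_le]; constructor <;> linarith [h.1, h.2]
  have hx : ∀ k, |η * (1 - β k) * S k| ≤ |1 - β k| / 2 := fun k => by
    have h := hS k
    rw [abs_mul, abs_mul, abs_of_pos hη, abs_of_nonneg h.1]
    have h1 : η * S k ≤ 1 / 2 := le_trans (mul_le_mul_of_nonneg_left h.2 hη.le) hηM
    nlinarith [mul_le_mul_of_nonneg_left h1 (hd0 k)]
  have he : ∀ k, |Real.exp (η * (1 - β k) * S k) - 1| ≤ 3 / 4 * |1 - β k| := fun k => by
    have h1 := hx k
    have h2 := hd1 k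
    generalize η * (1 - β k) * S k = x at *
    have h3 := Real.abs_exp_sub_one_sub_id_le (x := x) (by linarith)
    have h4 : |Real.exp x - 1| ≤ |Real.exp x - 1 - x| + |x| := by
      have := abs_add_le (Real.exp x - 1 - x) x
      simpa using this
    have h5 : x ^ 2 ≤ |x| / 2 := by
      rw [← sq_abs]; nlinarith [abs_nonneg x]
    linarith
  have hel : ∀ k, 1 / 2 ≤ Real.exp (η * (1 - β k) * S k) := fun k => by
    have h1 := Real.add_one_le_exp (η * (1 - β k) * S k)
    have h2 := (abs_le.1 (hx k)).1
    linarith [hd1 k]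
  generalize hE : (fun k => Real.exp (η * (1 - β k) * S k)) = e at *
  have hE' : ∀ k, Real.exp (η * (1 - β k) * S k) = e k := fun k => by rw [← hE]
  simp only [hE'] at hp he hel
  have hsq : ∀ k, (1 - β k) ^ 2 = |1 - β k| ^ 2 := fun k => (sq_abs _).symm
  simp only [hsq]
  generalize hD : (fun k => |1 - β k|) = d at *
  have hD' : ∀ k, |1 - β k| = d k := fun k => by rw [← hD]
  simp only [hD'] at *
  obtain ⟨Z, hZ⟩ : ∃ Z, Z = ∑ j, pt j * e j := ⟨_, rfl⟩
  rw [← hZ] at hp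
  obtain ⟨D, hDD⟩ : ∃ D, D = ∑ j, pt j * d j := ⟨_, rfl⟩
  have hZ2 : 1 / 2 ≤ Z := by
    calc (1 / 2 : ℝ) = ∑ j, pt j * (1 / 2) := by rw [← Finset.sum_mul, hpt1]; norm_num
      _ ≤ Z := by
        rw [hZ]
        exact Finset.sum_le_sum fun j _ => mul_le_mul_of_nonneg_left (hel j) (hpt0 j)
  have hZ1 : |Z - 1| ≤ 3 / 4 * D := by
    have : Z - 1 = ∑ j, pt j * (e j - 1) := by
      simp only [mul_sub, Finset.sum_sub_distrib, mul_one, hpt1, hZ]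
    rw [this, hDD, Finset.mul_sum]
    refine (Finset.abs_sum_le_sum_abs _ _).trans (Finset.sum_le_sum fun j _ => ?_)
    rw [abs_mul, abs_of_nonneg (hpt0 j)]
    nlinarith [mul_le_mul_of_nonneg_left (he j) (hpt0 j)]
  have hDsq : D ^ 2 ≤ ∑ k, pt k * d k ^ 2 := by
    have h : 0 ≤ ∑ k, pt k * (d k - D) ^ 2 :=
      Finset.sum_nonneg fun k _ => mul_nonneg (hpt0 k) (sq_nonneg _)
    have h2 : ∑ k, pt k * (d k - D) ^ 2
        = ∑ k, pt k * d k ^ 2 - 2 * D * ∑ k, pt k * d k + D ^ 2 * ∑ k, pt k := by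
      rw [Finset.mul_sum, Finset.mul_sum, ← Finset.sum_sub_distrib, ← Finset.sum_add_distrib]
      exact Finset.sum_congr rfl fun k _ => by ring
    rw [h2, ← hDD, hpt1] at h
    nlinarith
  have hterm : ∀ k, |pt k - p k| * d k ≤ 3 / 2 * (pt k * d k ^ 2) + 3 / 2 * D * (pt k * d k) := by
    intro k
    have hZp : 0 < Z := by linarith
    have h1 : pt k - p k = pt k * ((Z - e k) / Z) := by
      rw [hp k]; field_simp
    have h2 : |(Z - e k) / Z| ≤ 3 / 2 * d k + 3 / 2 * D := by
      rw [abs_div, abs_of_pos hZp, div_le_iff₀ hZp]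
      have h3 : |Z - e k| ≤ 3 / 4 * D + 3 / 4 * d k := by
        have h4 := abs_sub (Z - 1) (e k - 1)
        have h5 := he k
        rw [show Z - e k = (Z - 1) - (e k - 1) by ring]
        linarith
      have h6 : 0 ≤ 3 / 4 * D + 3 / 4 * d k := (abs_nonneg _).trans h3
      nlinarith
    rw [h1, abs_mul, abs_of_nonneg (hpt0 k)]
    nlinarith [mul_le_mul_of_nonneg_left h2 (mul_nonneg (hpt0 k) (hd0 k))]
  refine (Finset.sum_le_sum fun k _ => hterm k).trans ?_
  rw [Finset.sum_add_distrib, ← Finset.mul_sum, ← Finset.mul_sum, ← hDD]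
  nlinarith
end
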